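/- arXiv:1712.05702 — 2 statements merged into one kernel-verified Lean document; each statement's English description precedes it below -/
import Mathlib

section
/- (Telescoping entropy bound for product states, inequality (lswtnanr) in the proof of Corollary 'eetelctit'.) Let d ≥ 2 and n ≥ 1, and let σ₁,…,σₙ and σ'₁,…,σ'ₙ be density matrices on ℂ^d with ‖σᵢ − σ'ᵢ‖₁ ≤ δ for every i, where 0 ≤ δ < 1/e. Let ⨂ᵢσᵢ denote the n-fold Kronecker product, i.e. the matrix indexed by functions f : Fin n → Fin d with entries (⨂ᵢσᵢ)(f,g) = ∏ᵢ σᵢ(f i, g i). Then |S(⨂ᵢσᵢ) − S(⨂ᵢσ'ᵢ)| ≤ 4nδ·log₂(d − 1) + 2n·h(δ). -/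
open scoped BigOperators ComplexOrder

/-- The von Neumann entropy (base-2) of a matrix, via its eigenvalues when Hermitian. -/
noncomputable def vnEntropy {n : Type*} [Fintype n] [DecidableEq n]
    (M : Matrix n n ℂ) : ℝ :=
  if h : M.IsHermitian then -∑ i, h.eigenvalues i * Real.logb 2 (h.eigenvalues i) else 0

/-- The trace norm of a Hermitian matrix: sum of absolute values of eigenvalues. -/
noncomputable def traceNorm {n : Type*} [Fintype n] [DecidableEq n]
    (M : Matrix n n ℂ) : ℝ :=
  if h : M.IsHermitian then ∑ i, |h.eigenvalues i| else 0

/-- The binary entropy function (base 2), with the convention `0 * logb 2 0 = 0`. -/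
noncomputable def binEntropy (x : ℝ) : ℝ :=
  -(x * Real.logb 2 x) - (1 - x) * Real.logb 2 (1 - x)
/-- The n-fold Kronecker product of matrices, indexed by functions Fin n → Fin d. -/
noncomputable def kronPow {n d : ℕ} (σ : Fin n → Matrix (Fin d) (Fin d) ℂ) :
    Matrix (Fin n → Fin d) (Fin n → Fin d) ℂ :=
  Matrix.of fun f g => ∏ i, σ i (f i) (g i)

open Real in
/-- `x ↦ -x log x` is subadditive on the nonnegative reals. -/
lemma negMulLog_add_le {x y : ℝ} (hx : 0 ≤ x) (hy : 0 ≤ y) :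
    negMulLog (x + y) ≤ negMulLog x + negMulLog y := by
  rcases hx.eq_or_lt with rfl | hx
  · simp
  rcases hy.eq_or_lt with rfl | hy
  · simp
  have h1 : log x ≤ log (x + y) := log_le_log hx (by linarith)
  have h2 : log y ≤ log (x + y) := log_le_log hy (by linarith)
  simp only [negMulLog]
  nlinarith

open Real in
lemma le_negMulLog_of_le_exp_neg_one {t : ℝ} (ht : 0 ≤ t) (hte : t ≤ exp (-1)) :
    t ≤ negMulLog t := by
  rcases ht.eq_or_lt with rfl | ht
  · simp
  have h : log t ≤ -1 := by simpa using log_le_log ht hte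
  simp only [negMulLog]
  nlinarith

open Real in
lemma negMulLog_le_negMulLog_of_le_exp_neg_one {s t : ℝ} (hs : 0 ≤ s) (hst : s ≤ t)
    (hte : t ≤ exp (-1)) : negMulLog s ≤ negMulLog t := by
  rcases hs.eq_or_lt with rfl | hs
  · simpa using hst.trans (le_negMulLog_of_le_exp_neg_one hst hte)
  have ht : 0 < t := hs.trans_le hst
  have h : log t ≤ -1 := by simpa using log_le_log ht hte
  have h2 : log (t / s) ≤ t / s - 1 := log_le_sub_one_of_pos (by positivity)
  rw [log_div ht.ne' hs.ne'] at h2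
  have h3 : s * (log t - log s) ≤ t - s := by
    calc s * (log t - log s) ≤ s * (t / s - 1) := by gcongr
      _ = t - s := by field_simp
  simp only [negMulLog]
  nlinarith

open Real in
/-- Modulus of continuity of `x ↦ -x log x` on the unit interval. -/
lemma negMulLog_sub_le {x y : ℝ} (hx : 0 ≤ x) (hy : 0 ≤ y) (hy1 : y ≤ 1)
    (hxy : |x - y| ≤ exp (-1)) : negMulLog x - negMulLog y ≤ negMulLog |x - y| := by
  rcases le_total y x with h | h
  · rw [abs_of_nonneg (sub_nonneg.2 h)]
    have := negMulLog_add_le hy (sub_nonneg.2 h)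
    rw [add_sub_cancel] at this
    linarith
  · refine le_trans ?_ (le_negMulLog_of_le_exp_neg_one (abs_nonneg _) hxy)
    rw [abs_of_nonpos (sub_nonpos.2 h)]
    rcases hx.eq_or_lt with rfl | hx
    · have := negMulLog_nonneg hy hy1
      simp only [negMulLog_zero]
      linarith
    have hy0 : 0 < y := hx.trans_le h
    have h2 : log (y / x) ≤ y / x - 1 := log_le_sub_one_of_pos (by positivity)
    rw [log_div hy0.ne' hx.ne'] at h2
    have h3 : x * (log y - log x) ≤ y - x := by
      calc x * (log y - log x) ≤ x * (y / x - 1) := by gcongr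
        _ = y - x := by field_simp
    have h4 : log y ≤ 0 := log_nonpos hy hy1
    simp only [negMulLog]
    nlinarith

open Real in
/-- Among nonnegative vectors of given sum, the uniform one has the largest entropy. -/
lemma sum_negMulLog_le {ι : Type*} [Fintype ι] [Nonempty ι] {t : ι → ℝ} (ht : ∀ i, 0 ≤ t i) :
    ∑ i, negMulLog (t i) ≤ (∑ i, t i) * log (Fintype.card ι) + negMulLog (∑ i, t i) := by
  have hd : (0 : ℝ) < Fintype.card ι := by exact_mod_cast Fintype.card_pos
  have h := concaveOn_negMulLog.le_map_sum (t := Finset.univ) (w := fun _ : ι ↦ (Fintype.card ι : ℝ)⁻¹)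
    (p := t) (fun _ _ ↦ by positivity) (by simp) (fun i _ ↦ ht i)
  simp only [smul_eq_mul, ← Finset.mul_sum] at h
  rw [negMulLog_mul] at h
  have h' := mul_le_mul_of_nonneg_left h hd.le
  rw [mul_inv_cancel_left₀ hd.ne'] at h'
  refine h'.trans_eq ?_
  simp only [negMulLog, log_inv]
  field_simp

open Real in
/-- Fannes' inequality for finite probability vectors. -/
lemma sum_negMulLog_sub_le {ι : Type*} [Fintype ι] [Nonempty ι] {p q : ι → ℝ}
    (hp : ∀ i, 0 ≤ p i) (hq : ∀ i, 0 ≤ q i) (hq1 : ∀ i, q i ≤ 1) {δ : ℝ}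
    (hpq : ∑ i, |p i - q i| ≤ δ) (hδ : δ ≤ exp (-1)) :
    ∑ i, negMulLog (p i) - ∑ i, negMulLog (q i) ≤ δ * log (Fintype.card ι) + negMulLog δ := by
  have hcard : 0 ≤ log (Fintype.card ι) := log_natCast_nonneg _
  have h0 : 0 ≤ ∑ i, |p i - q i| := Finset.sum_nonneg fun _ _ ↦ abs_nonneg _
  calc ∑ i, negMulLog (p i) - ∑ i, negMulLog (q i)
      = ∑ i, (negMulLog (p i) - negMulLog (q i)) := by rw [Finset.sum_sub_distrib]
    _ ≤ ∑ i, negMulLog |p i - q i| := Finset.sum_le_sum fun i hi ↦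
        negMulLog_sub_le (hp i) (hq i) (hq1 i)
          (((Finset.single_le_sum (fun j _ ↦ abs_nonneg (p j - q j)) hi).trans hpq).trans hδ)
    _ ≤ _ := sum_negMulLog_le fun _ ↦ abs_nonneg _
    _ ≤ _ := add_le_add (mul_le_mul_of_nonneg_right hpq hcard)
        (negMulLog_le_negMulLog_of_le_exp_neg_one h0 hpq hδ)

section Spectral

variable {n : Type*} [Fintype n] [DecidableEq n] {A B : Matrix n n ℂ}

lemma Matrix.IsHermitian.eq_unitary_mul_diagonal_mul (hA : A.IsHermitian) :
    A = (hA.eigenvectorUnitary : Matrix n n ℂ) *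
      Matrix.diagonal (fun i ↦ (hA.eigenvalues i : ℂ)) *
      star (hA.eigenvectorUnitary : Matrix n n ℂ) := by
  conv_lhs => rw [hA.spectral_theorem, Unitary.conjStarAlgAut_apply]
  rfl

/-- The squared moduli of the entries of a unitary matrix form a doubly stochastic matrix. -/
lemma Matrix.normSq_mem_doublyStochastic {V : Matrix n n ℂ} (hV : V ∈ Matrix.unitaryGroup n ℂ) :
    (Matrix.of fun i j ↦ Complex.normSq (V i j)) ∈ doublyStochastic ℝ n := by
  rw [mem_doublyStochastic_iff_sum]
  refine ⟨fun i j ↦ Complex.normSq_nonneg _, fun i ↦ ?_, fun j ↦ ?_⟩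
  · have h := congrFun (congrFun (Matrix.mem_unitaryGroup_iff.1 hV) i) i
    simp only [Matrix.mul_apply, Matrix.star_apply, Matrix.one_apply_eq] at h
    have h2 : ((∑ j, Complex.normSq (V i j) : ℝ) : ℂ) = 1 := by
      rw [← h]
      push_cast
      exact Finset.sum_congr rfl fun j _ ↦ (Complex.mul_conj _).symm
    exact_mod_cast h2
  · have h := congrFun (congrFun (Matrix.mem_unitaryGroup_iff'.1 hV) j) j
    simp only [Matrix.mul_apply, Matrix.star_apply, Matrix.one_apply_eq] at h
    have h2 : ((∑ i, Complex.normSq (V i j) : ℝ) : ℂ) = 1 := by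
      rw [← h]
      push_cast
      exact Finset.sum_congr rfl fun i _ ↦ Complex.normSq_eq_conj_mul_self
    exact_mod_cast h2

/-- In any orthonormal basis, the diagonal of a Hermitian matrix is a doubly stochastic image of
its eigenvalues. -/
lemma Matrix.IsHermitian.exists_doublyStochastic_diag (hA : A.IsHermitian)
    (U : Matrix.unitaryGroup n ℂ) :
    ∃ S ∈ doublyStochastic ℝ n, ∀ i,
      ((star (U : Matrix n n ℂ) * A * U) i i).re = ∑ j, S i j * hA.eigenvalues j := by
  refine ⟨_, Matrix.normSq_mem_doublyStochastic (star U * hA.eigenvectorUnitary).2, fun i ↦ ?_⟩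
  set V : Matrix n n ℂ := ((star U * hA.eigenvectorUnitary : Matrix.unitaryGroup n ℂ) : Matrix n n ℂ)
    with hV
  have h : star (U : Matrix n n ℂ) * A * U =
      V * Matrix.diagonal (fun i ↦ (hA.eigenvalues i : ℂ)) * star V := by
    conv_lhs => rw [hA.eq_unitary_mul_diagonal_mul]
    simp [hV, Matrix.mul_assoc]
  have h2 : (V * Matrix.diagonal (fun i ↦ (hA.eigenvalues i : ℂ)) * star V) i i =
      ((∑ j, Complex.normSq (V i j) * hA.eigenvalues j : ℝ) : ℂ) := by
    rw [Matrix.mul_apply]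
    push_cast
    refine Finset.sum_congr rfl fun j _ ↦ ?_
    rw [Matrix.mul_diagonal, Matrix.star_apply, ← Complex.mul_conj]
    simp only [RCLike.star_def]
    ring
  rw [h, h2, Complex.ofReal_re]
  rfl

lemma Matrix.IsHermitian.vnEntropy_eq (hA : A.IsHermitian) :
    vnEntropy A = (∑ i, Real.negMulLog (hA.eigenvalues i)) / Real.log 2 := by
  rw [vnEntropy, dif_pos hA, ← Finset.sum_neg_distrib, Finset.sum_div]
  refine Finset.sum_congr rfl fun i _ ↦ ?_
  simp only [Real.negMulLog, Real.logb]
  ring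

/-- The entropy can be computed from any unitary diagonalization. -/
lemma vnEntropy_unitary_conj_diagonal {U : Matrix n n ℂ} (hU : U ∈ Matrix.unitaryGroup n ℂ)
    (v : n → ℝ) :
    vnEntropy (U * Matrix.diagonal (fun i ↦ (v i : ℂ)) * star U) =
      (∑ i, Real.negMulLog (v i)) / Real.log 2 := by
  set M := U * Matrix.diagonal (fun i ↦ (v i : ℂ)) * star U with hM
  have hH : M.IsHermitian := by
    refine Matrix.isHermitian_mul_mul_conjTranspose U ?_
    exact Matrix.isHermitian_diagonal_of_self_adjoint _ (by ext i; simp)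
  have hroots : M.charpoly.roots = Finset.univ.val.map (fun i ↦ (v i : ℂ)) := by
    rw [hM, Matrix.charpoly_mul_comm, ← mul_assoc, Matrix.mem_unitaryGroup_iff'.1 hU, one_mul,
      Matrix.charpoly_diagonal, Polynomial.roots_prod]
    · simp
    · simp [Finset.prod_ne_zero_iff, Polynomial.X_sub_C_ne_zero]
  rw [hH.roots_charpoly_eq_eigenvalues] at hroots
  have h := congrArg (fun s ↦ (s.map fun z : ℂ ↦ Real.negMulLog z.re).sum) hroots
  simp only [Multiset.map_map] at h
  rw [hH.vnEntropy_eq]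
  congr 1

lemma Matrix.IsHermitian.sum_eigenvalues (hA : A.IsHermitian) (htr : A.trace = 1) :
    ∑ i, hA.eigenvalues i = 1 := by
  have h := hA.trace_eq_sum_eigenvalues
  rw [htr] at h
  have h' : ((∑ i, hA.eigenvalues i : ℝ) : ℂ) = 1 := by
    push_cast
    exact h.symm
  exact_mod_cast h'

/-- Fannes' inequality, one-sided. -/
lemma vnEntropy_sub_le (hA : A.PosSemidef) (hAtr : A.trace = 1) (hB : B.PosSemidef)
    (hBtr : B.trace = 1) {δ : ℝ} (hδ : δ ≤ Real.exp (-1)) (hdist : traceNorm (A - B) ≤ δ) :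
    vnEntropy A - vnEntropy B ≤
      (δ * Real.log (Fintype.card n) + Real.negMulLog δ) / Real.log 2 := by
  have : Nonempty n := by
    by_contra h
    rw [not_nonempty_iff] at h
    simp [Matrix.trace] at hAtr
  have hD : (A - B).IsHermitian := hA.1.sub hB.1
  have hlog : 0 < Real.log 2 := Real.log_pos one_lt_two
  set U := hB.1.eigenvectorUnitary
  obtain ⟨S, hS, hSA⟩ := hA.1.exists_doublyStochastic_diag U
  obtain ⟨T, hT, hTD⟩ := hD.exists_doublyStochastic_diag U
  set p : n → ℝ := fun i ↦ ((star (U : Matrix n n ℂ) * A * U) i i).re with hp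
  have hBdiag : ∀ i, ((star (U : Matrix n n ℂ) * B * U) i i).re = hB.1.eigenvalues i := by
    intro i
    have h : star (U : Matrix n n ℂ) * B * U =
        Matrix.diagonal (fun i ↦ (hB.1.eigenvalues i : ℂ)) := by
      conv_lhs => rw [hB.1.eq_unitary_mul_diagonal_mul]
      simp [U, Matrix.mul_assoc]
      simp [← Matrix.mul_assoc]
    simp [h]
  have hpq : ∑ i, |p i - hB.1.eigenvalues i| ≤ δ := by
    calc ∑ i, |p i - hB.1.eigenvalues i| = ∑ i, |∑ j, T i j * hD.eigenvalues j| := by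
          refine Finset.sum_congr rfl fun i _ ↦ ?_
          rw [← hTD i, ← hBdiag i, hp]
          simp [mul_sub, sub_mul]
      _ ≤ ∑ i, ∑ j, T i j * |hD.eigenvalues j| := by
          refine Finset.sum_le_sum fun i _ ↦ (Finset.abs_sum_le_sum_abs _ _).trans_eq ?_
          refine Finset.sum_congr rfl fun j _ ↦ ?_
          rw [abs_mul, abs_of_nonneg (nonneg_of_mem_doublyStochastic hT)]
      _ = ∑ j, |hD.eigenvalues j| := by
          rw [Finset.sum_comm]
          simp only [← Finset.sum_mul, sum_col_of_mem_doublyStochastic hT, one_mul]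
      _ ≤ δ := by rwa [traceNorm, dif_pos hD] at hdist
  have hp0 : ∀ i, 0 ≤ p i := fun i ↦ by
    rw [hp]
    simp only [hSA]
    exact Finset.sum_nonneg fun j _ ↦
      mul_nonneg (nonneg_of_mem_doublyStochastic hS) (hA.eigenvalues_nonneg j)
  have hSchur : ∑ j, Real.negMulLog (hA.1.eigenvalues j) ≤ ∑ i, Real.negMulLog (p i) := by
    calc ∑ j, Real.negMulLog (hA.1.eigenvalues j)
        = ∑ i, ∑ j, S i j * Real.negMulLog (hA.1.eigenvalues j) := by
          rw [Finset.sum_comm]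
          simp only [← Finset.sum_mul, sum_col_of_mem_doublyStochastic hS, one_mul]
      _ ≤ ∑ i, Real.negMulLog (p i) := by
          refine Finset.sum_le_sum fun i _ ↦ ?_
          simp only [hp, hSA]
          exact Real.concaveOn_negMulLog.le_map_sum
            (fun j _ ↦ nonneg_of_mem_doublyStochastic hS) (sum_row_of_mem_doublyStochastic hS i)
            (fun j _ ↦ hA.eigenvalues_nonneg j)
  have hq1 : ∀ i, hB.1.eigenvalues i ≤ 1 := fun i ↦ by
    rw [← hB.1.sum_eigenvalues hBtr]
    exact Finset.single_le_sum (fun j _ ↦ hB.eigenvalues_nonneg j) (Finset.mem_univ i)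
  have hF := sum_negMulLog_sub_le hp0 hB.eigenvalues_nonneg hq1 hpq hδ
  rw [hA.1.vnEntropy_eq, hB.1.vnEntropy_eq, ← sub_div]
  gcongr
  linarith

lemma traceNorm_neg (hA : A.IsHermitian) : traceNorm (-A) = traceNorm A := by
  rw [traceNorm, traceNorm, dif_pos hA, dif_pos hA.neg]
  have hroots : (-A).charpoly.roots = Finset.univ.val.map (fun i ↦ ((-hA.eigenvalues i : ℝ) : ℂ)) := by
    conv_lhs => rw [hA.eq_unitary_mul_diagonal_mul]
    rw [← Matrix.neg_mul, ← Matrix.mul_neg, Matrix.charpoly_mul_comm, ← mul_assoc,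
      Unitary.coe_star_mul_self, one_mul, Matrix.diagonal_neg,
      Matrix.charpoly_diagonal, Polynomial.roots_prod]
    · simp
    · simp [Finset.prod_ne_zero_iff, Polynomial.X_add_C_ne_zero]
  rw [hA.neg.roots_charpoly_eq_eigenvalues] at hroots
  have h := congrArg (fun s ↦ (s.map fun z : ℂ ↦ |z.re|).sum) hroots
  simp only [Multiset.map_map, Function.comp_def, Complex.ofReal_re, abs_neg] at h
  exact h

end Spectral

section Kronecker

variable {n d : ℕ}

lemma kronPow_mul (σ τ : Fin n → Matrix (Fin d) (Fin d) ℂ) :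
    kronPow (fun i ↦ σ i * τ i) = kronPow σ * kronPow τ := by
  ext f g
  simp only [kronPow, Matrix.of_apply, Matrix.mul_apply, Finset.prod_univ_sum,
    Fintype.piFinset_univ, Finset.prod_mul_distrib]

lemma star_kronPow (σ : Fin n → Matrix (Fin d) (Fin d) ℂ) :
    star (kronPow σ) = kronPow (fun i ↦ star (σ i)) := by
  ext f g
  simp [kronPow, Matrix.star_apply]

lemma kronPow_diagonal (v : Fin n → Fin d → ℂ) :
    kronPow (fun i ↦ Matrix.diagonal (v i)) = Matrix.diagonal (fun f ↦ ∏ i, v i (f i)) := by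
  ext f g
  by_cases h : f = g
  · subst h
    simp [kronPow]
  · obtain ⟨i, hi⟩ := Function.ne_iff.1 h
    rw [Matrix.diagonal_apply_ne _ h]
    exact Finset.prod_eq_zero (Finset.mem_univ i) (Matrix.diagonal_apply_ne _ hi)

lemma kronPow_mem_unitaryGroup {U : Fin n → Matrix (Fin d) (Fin d) ℂ}
    (hU : ∀ i, U i ∈ Matrix.unitaryGroup (Fin d) ℂ) :
    kronPow U ∈ Matrix.unitaryGroup (Fin n → Fin d) ℂ := by
  rw [Matrix.mem_unitaryGroup_iff, star_kronPow, ← kronPow_mul]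
  simp only [fun i ↦ Matrix.mem_unitaryGroup_iff.1 (hU i)]
  have h := kronPow_diagonal (n := n) (d := d) (fun _ _ ↦ 1)
  simpa using h

lemma negMulLog_prod {ι : Type*} [DecidableEq ι] (s : Finset ι) (x : ι → ℝ) :
    Real.negMulLog (∏ i ∈ s, x i) =
      ∑ i ∈ s, ∏ j ∈ s, if j = i then Real.negMulLog (x j) else x j := by
  induction s using Finset.induction_on with
  | empty => simp
  | insert a s ha ih =>
    rw [Finset.prod_insert ha, Real.negMulLog_mul, Finset.sum_insert ha, Finset.prod_insert ha,
      if_pos rfl, ih, Finset.mul_sum]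
    congr 1
    · rw [mul_comm]
      congr 1
      refine Finset.prod_congr rfl fun j hj ↦ ?_
      rw [if_neg (ne_of_mem_of_not_mem hj ha)]
    · refine Finset.sum_congr rfl fun i hi ↦ ?_
      rw [Finset.prod_insert ha, if_neg (ne_of_mem_of_not_mem hi ha).symm]

/-- Additivity of the Shannon entropy for product distributions. -/
lemma sum_negMulLog_prod {ι κ : Type*} [Fintype ι] [DecidableEq ι] [Fintype κ] {v : ι → κ → ℝ}
    (hv : ∀ i, ∑ k, v i k = 1) :
    ∑ f : ι → κ, Real.negMulLog (∏ i, v i (f i)) = ∑ i, ∑ k, Real.negMulLog (v i k) := by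
  simp only [negMulLog_prod]
  rw [Finset.sum_comm]
  refine Finset.sum_congr rfl fun i _ ↦ ?_
  have h := Finset.sum_prod_piFinset (Finset.univ : Finset κ)
    (fun j k ↦ if j = i then Real.negMulLog (v j k) else v j k)
  rw [Fintype.piFinset_univ] at h
  rw [h, Finset.prod_eq_single i]
  · simp
  · intro j _ hj
    simp [hj, hv]
  · simp

/-- Additivity of the von Neumann entropy for product states. -/
lemma vnEntropy_kronPow {σ : Fin n → Matrix (Fin d) (Fin d) ℂ} (hσ : ∀ i, (σ i).IsHermitian)
    (htr : ∀ i, (σ i).trace = 1) : vnEntropy (kronPow σ) = ∑ i, vnEntropy (σ i) := by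
  have h : kronPow σ = kronPow (fun i ↦ ((hσ i).eigenvectorUnitary : Matrix _ _ ℂ)) *
      Matrix.diagonal (fun f ↦ ((∏ i, (hσ i).eigenvalues (f i) : ℝ) : ℂ)) *
      star (kronPow (fun i ↦ ((hσ i).eigenvectorUnitary : Matrix _ _ ℂ))) := by
    push_cast
    rw [star_kronPow, ← kronPow_diagonal (fun i k ↦ ((hσ i).eigenvalues k : ℂ)), ← kronPow_mul, ← kronPow_mul]
    exact congrArg kronPow (funext fun i ↦ (hσ i).eq_unitary_mul_diagonal_mul)
  rw [h, vnEntropy_unitary_conj_diagonal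
      (kronPow_mem_unitaryGroup fun i ↦ (hσ i).eigenvectorUnitary.2),
    sum_negMulLog_prod fun i ↦ (hσ i).sum_eigenvalues (htr i), Finset.sum_div]
  exact Finset.sum_congr rfl fun i _ ↦ (hσ i).vnEntropy_eq.symm

end Kronecker

open Real in
lemma fannes_bound_le {d : ℕ} (hd : 2 ≤ d) {δ : ℝ} (hδ0 : 0 ≤ δ) (hδ1 : δ ≤ exp (-1)) :
    (δ * log d + negMulLog δ) / log 2 ≤ 4 * δ * logb 2 ((d : ℝ) - 1) + 2 * _root_.binEntropy δ := by
  have hlog : 0 < log 2 := log_pos one_lt_two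
  have hη : δ ≤ negMulLog δ := le_negMulLog_of_le_exp_neg_one hδ0 hδ1
  have hδ' : δ ≤ 1 := hδ1.trans (exp_le_one_iff.2 (by norm_num))
  have hη' : 0 ≤ negMulLog (1 - δ) := negMulLog_nonneg (by linarith) (by linarith)
  have hR : 4 * δ * logb 2 ((d : ℝ) - 1) + 2 * _root_.binEntropy δ =
      (4 * δ * log ((d : ℝ) - 1) + 2 * (negMulLog δ + negMulLog (1 - δ))) / log 2 := by
    simp only [_root_.binEntropy, logb, negMulLog]
    field_simp
    ring
  rw [hR]
  refine div_le_div_of_nonneg_right ?_ hlog.le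
  rcases hd.eq_or_lt with rfl | hd
  · have h2 : log 2 ≤ 1 := by linarith [log_two_lt_d9]
    norm_num
    nlinarith
  · have hd3 : (3 : ℝ) ≤ d := by exact_mod_cast hd
    have h : log d ≤ 2 * log ((d : ℝ) - 1) := by
      rw [show 2 * log ((d : ℝ) - 1) = log (((d : ℝ) - 1) ^ 2) by rw [log_pow]; norm_num]
      exact log_le_log (by linarith) (by nlinarith)
    have h0 : 0 ≤ log ((d : ℝ) - 1) := log_nonneg (by linarith)
    nlinarith [mul_le_mul_of_nonneg_left h hδ0, mul_nonneg hδ0 h0]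

/-- **Telescoping entropy bound for product states.** -/
theorem telescoping_entropy_bound (d n : ℕ) (hd : 2 ≤ d) (hn : 1 ≤ n)
    (σ σ' : Fin n → Matrix (Fin d) (Fin d) ℂ)
    (hσ : ∀ i, (σ i).PosSemidef) (hσtr : ∀ i, (σ i).trace = 1)
    (hσ' : ∀ i, (σ' i).PosSemidef) (hσ'tr : ∀ i, (σ' i).trace = 1)
    (δ : ℝ) (hδ0 : 0 ≤ δ) (hδ1 : δ < 1 / Real.exp 1)
    (hdist : ∀ i, traceNorm (σ i - σ' i) ≤ δ) :
    |vnEntropy (kronPow σ) - vnEntropy (kronPow σ')|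
      ≤ 4 * n * δ * Real.logb 2 ((d : ℝ) - 1) + 2 * n * binEntropy δ := by
  have hδ : δ ≤ Real.exp (-1) := by
    rw [Real.exp_neg, ← one_div]
    exact hδ1.le
  have hsingle (i : Fin n) : |vnEntropy (σ i) - vnEntropy (σ' i)| ≤
      4 * δ * Real.logb 2 ((d : ℝ) - 1) + 2 * binEntropy δ := by
    have h1 := vnEntropy_sub_le (hσ i) (hσtr i) (hσ' i) (hσ'tr i) hδ (hdist i)
    have h2 := vnEntropy_sub_le (hσ' i) (hσ'tr i) (hσ i) (hσtr i) hδ (by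
      rw [← neg_sub, traceNorm_neg ((hσ i).1.sub (hσ' i).1)]
      exact hdist i)
    rw [Fintype.card_fin] at h1 h2
    have h3 := fannes_bound_le hd hδ0 hδ
    rw [abs_le]
    constructor <;> linarith
  rw [vnEntropy_kronPow (fun i ↦ (hσ i).1) hσtr, vnEntropy_kronPow (fun i ↦ (hσ' i).1) hσ'tr,
    ← Finset.sum_sub_distrib]
  calc |∑ i, (vnEntropy (σ i) - vnEntropy (σ' i))|
      ≤ ∑ i, |vnEntropy (σ i) - vnEntropy (σ' i)| := Finset.abs_sum_le_sum_abs _ _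
    _ ≤ ∑ _i : Fin n, (4 * δ * Real.logb 2 ((d : ℝ) - 1) + 2 * binEntropy δ) :=
        Finset.sum_le_sum fun i _ ↦ hsingle i
    _ = _ := by
        rw [Finset.sum_const, Finset.card_univ, Fintype.card_fin, nsmul_eq_mul]
        ring
end

section
/- (Holevo quantity of an ensemble close to a constant state, the estimate used in the security analysis of the main code construction.) Let d ≥ 2, let Ξ and ζ₁,…,ζ_N be density matrices on ℂ^d with ‖ζᵢ − Ξ‖₁ ≤ ε for every i ∈ {1,…,N}, where 0 ≤ ε < 1/e. Then the Holevo quantity of the uniform ensemble satisfies S((1/N)∑ᵢ ζᵢ) − (1/N)∑ᵢ S(ζᵢ) ≤ 2ε·log₂(d − 1) + 2h(ε). -/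
open scoped BigOperators ComplexOrder

open Matrix

theorem vnEntropy_mul_log_two {n : Type*} [Fintype n] [DecidableEq n] {A : Matrix n n ℂ}
    (hA : A.IsHermitian) :
    vnEntropy A * Real.log 2 = ∑ i, Real.negMulLog (hA.eigenvalues i) := by
  have h2 : Real.log 2 ≠ 0 := (Real.log_pos one_lt_two).ne'
  rw [vnEntropy, dif_pos hA, neg_mul, Finset.sum_mul, ← Finset.sum_neg_distrib]
  refine Finset.sum_congr rfl fun i _ => ?_
  rw [Real.negMulLog, Real.logb]
  field_simp

theorem Matrix.IsHermitian.exists_unitary_diagonalization {n : Type*} [Fintype n] [DecidableEq n]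
    {A : Matrix n n ℂ} (hA : A.IsHermitian) :
    ∃ U : Matrix n n ℂ, Uᴴ * U = 1 ∧ U * Uᴴ = 1 ∧
      A = U * diagonal (fun i => (hA.eigenvalues i : ℂ)) * Uᴴ := by
  refine ⟨hA.eigenvectorUnitary, ?_, ?_, ?_⟩
  · exact Unitary.coe_star_mul_self hA.eigenvectorUnitary
  · exact Unitary.coe_mul_star_self hA.eigenvectorUnitary
  · exact hA.spectral_theorem

/-- The diagonal entries of an orthogonal projection are at most one. -/
theorem Matrix.IsHermitian.re_apply_self_le_one {K : Type*} [Fintype K] {E : Matrix K K ℂ}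
    (hE : E.IsHermitian) (hEE : E * E = E) (k : K) : (E k k).re ≤ 1 := by
  have h1 : (E k k).re = ∑ l, ‖E k l‖ ^ 2 := by
    have h : E k k = ∑ l, ((‖E k l‖ ^ 2 : ℝ) : ℂ) := by
      conv_lhs => rw [← hEE, Matrix.mul_apply]
      refine Finset.sum_congr rfl fun l _ => ?_
      rw [← hE.apply l k, RCLike.star_def, Complex.mul_conj']
      push_cast; rfl
    rw [h, ← Complex.ofReal_sum, Complex.ofReal_re]
  have h2 : ‖E k k‖ ^ 2 ≤ ∑ l, ‖E k l‖ ^ 2 :=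
    Finset.single_le_sum (f := fun l => ‖E k l‖ ^ 2) (fun l _ => sq_nonneg _) (Finset.mem_univ k)
  have h3 := Complex.abs_re_le_norm (E k k)
  have h4 := sq_abs (E k k).re
  nlinarith [abs_nonneg (E k k).re]

theorem re_conjTranspose_mul_self_apply {n K : Type*} [Fintype n] (Y : Matrix n K ℂ) (k : K) :
    ((Yᴴ * Y) k k).re = ∑ j, ‖Y j k‖ ^ 2 := by
  rw [Matrix.mul_apply, Complex.re_sum]
  refine Finset.sum_congr rfl fun j _ => ?_
  rw [conjTranspose_apply, RCLike.star_def, Complex.conj_mul', ← Complex.ofReal_pow,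
    Complex.ofReal_re]

/-- Schur–Horn type entropy inequality: if the rows of `Y` are orthogonal, then the entropy of the
squared row norms is at most the entropy of the squared column norms. -/
theorem sum_negMulLog_le_of_mul_conjTranspose_eq_diagonal {n K : Type*} [Fintype n] [DecidableEq n]
    [Fintype K] {Y : Matrix n K ℂ} {w : n → ℝ}
    (hY : Y * Yᴴ = diagonal (fun i => (w i : ℂ))) :
    ∑ j, Real.negMulLog (w j) ≤ ∑ k, Real.negMulLog ((Yᴴ * Y) k k).re := by
  have hrow (j : n) : ∑ k, ‖Y j k‖ ^ 2 = w j := by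
    have h := re_conjTranspose_mul_self_apply Yᴴ j
    rw [conjTranspose_conjTranspose, hY, diagonal_apply_eq, Complex.ofReal_re] at h
    rw [h]
    simp
  have hw (j : n) : 0 ≤ w j := hrow j ▸ Finset.sum_nonneg fun k _ => sq_nonneg _
  have hzero (j : n) (k : K) : ‖Y j k‖ ^ 2 / w j * w j = ‖Y j k‖ ^ 2 := by
    rcases eq_or_ne (w j) 0 with h | h
    · have := (Finset.sum_eq_zero_iff_of_nonneg (fun k _ => sq_nonneg ‖Y j k‖)).1
        ((hrow j).trans h) k (Finset.mem_univ k)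
      rw [this]; simp
    · field_simp
  have hcol (k : K) : ∑ j, ‖Y j k‖ ^ 2 / w j ≤ 1 := by
    set D : Matrix n n ℂ := diagonal (fun i => ((w i)⁻¹ : ℂ)) with hD
    have hDH : Dᴴ = D := by simp [hD, diagonal_conjTranspose, Pi.star_def]
    have hDD : D * (Y * Yᴴ) * D = D := by
      rw [hY, hD, diagonal_mul_diagonal, diagonal_mul_diagonal]
      congr 1
      funext i
      rcases eq_or_ne (w i : ℂ) 0 with h | h
      · simp [h]
      · field_simp
    have hE : (Yᴴ * D * Y).IsHermitian := by
      rw [Matrix.IsHermitian, conjTranspose_mul, conjTranspose_mul, conjTranspose_conjTranspose,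
        hDH, Matrix.mul_assoc]
    have hEE : (Yᴴ * D * Y) * (Yᴴ * D * Y) = Yᴴ * D * Y := by
      calc _ = Yᴴ * (D * (Y * Yᴴ) * D) * Y := by simp only [Matrix.mul_assoc]
        _ = _ := by rw [hDD]
    refine le_trans (le_of_eq ?_) (hE.re_apply_self_le_one hEE k)
    rw [Matrix.mul_apply, Complex.re_sum]
    refine Finset.sum_congr rfl fun j _ => ?_
    rw [hD, mul_diagonal, conjTranspose_apply, mul_right_comm, RCLike.star_def, Complex.conj_mul',
      ← Complex.ofReal_pow, ← Complex.ofReal_inv, ← Complex.ofReal_mul, Complex.ofReal_re,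
      div_eq_mul_inv]
  have hjensen (k : K) :
      ∑ j, ‖Y j k‖ ^ 2 / w j * Real.negMulLog (w j) ≤ Real.negMulLog ((Yᴴ * Y) k k).re := by
    have h := Real.concaveOn_negMulLog.map_add_sum_le (t := Finset.univ)
      (w := fun j => ‖Y j k‖ ^ 2 / w j) (p := w) (v := 1 - ∑ j, ‖Y j k‖ ^ 2 / w j) (q := 0)
      (fun j _ => div_nonneg (sq_nonneg _) (hw j)) (by ring) (fun j _ => hw j)
      (by linarith [hcol k]) (by simp)
    simpa [hzero, re_conjTranspose_mul_self_apply] using h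
  calc ∑ j, Real.negMulLog (w j)
      = ∑ j, ∑ k, ‖Y j k‖ ^ 2 / w j * Real.negMulLog (w j) := by
        refine Finset.sum_congr rfl fun j _ => ?_
        rw [← Finset.sum_mul, ← Finset.sum_div, hrow]
        rcases eq_or_ne (w j) 0 with h | h
        · simp [h]
        · rw [div_self h, one_mul]
    _ = ∑ k, ∑ j, ‖Y j k‖ ^ 2 / w j * Real.negMulLog (w j) := Finset.sum_comm
    _ ≤ _ := Finset.sum_le_sum fun k _ => hjensen k

theorem exists_mul_conjTranspose_eq {n : Type*} [Fintype n] [DecidableEq n]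
    {A : Matrix n n ℂ} (hA : A.PosSemidef) :
    ∃ X : Matrix n n ℂ, X * Xᴴ = A ∧
      Xᴴ * X = diagonal (fun i => (hA.isHermitian.eigenvalues i : ℂ)) := by
  obtain ⟨U, hU, -, hA'⟩ := hA.isHermitian.exists_unitary_diagonalization
  set S : Matrix n n ℂ :=
    diagonal (fun i => (Real.sqrt (hA.isHermitian.eigenvalues i) : ℂ)) with hS
  have hSH : Sᴴ = S := by
    rw [hS, diagonal_conjTranspose]
    congr 1
    funext i
    simp
  have hSS : S * S = diagonal (fun i => (hA.isHermitian.eigenvalues i : ℂ)) := by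
    rw [hS, diagonal_mul_diagonal]
    congr 1
    funext i
    rw [← Complex.ofReal_mul, Real.mul_self_sqrt (hA.eigenvalues_nonneg i)]
  refine ⟨U * S, ?_, ?_⟩
  · rw [conjTranspose_mul, Matrix.mul_assoc, ← Matrix.mul_assoc S, hSH, hSS, ← Matrix.mul_assoc]
    exact hA'.symm
  · rw [conjTranspose_mul, Matrix.mul_assoc, ← Matrix.mul_assoc Uᴴ, hU, Matrix.one_mul, hSH, hSS]

/-- Measuring in an orthonormal basis does not decrease the entropy. -/
theorem vnEntropy_mul_log_two_le_sum_diag {n : Type*} [Fintype n] [DecidableEq n]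
    {A V : Matrix n n ℂ} (hA : A.PosSemidef) (hV : V * Vᴴ = 1) :
    vnEntropy A * Real.log 2 ≤ ∑ k, Real.negMulLog ((Vᴴ * A * V) k k).re := by
  obtain ⟨X, hX, hX'⟩ := exists_mul_conjTranspose_eq hA
  rw [vnEntropy_mul_log_two hA.isHermitian]
  have hY : (Xᴴ * V) * (Xᴴ * V)ᴴ = diagonal (fun i => (hA.isHermitian.eigenvalues i : ℂ)) := by
    rw [conjTranspose_mul, conjTranspose_conjTranspose, Matrix.mul_assoc, ← Matrix.mul_assoc V, hV,
      Matrix.one_mul, hX']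
  refine (sum_negMulLog_le_of_mul_conjTranspose_eq_diagonal hY).trans_eq ?_
  rw [conjTranspose_mul, conjTranspose_conjTranspose, ← hX]
  simp only [Matrix.mul_assoc]

theorem vnEntropy_add_le {n : Type*} [Fintype n] [DecidableEq n]
    {A B : Matrix n n ℂ} (hA : A.PosSemidef) (hB : B.PosSemidef) :
    vnEntropy (A + B) ≤ vnEntropy A + vnEntropy B := by
  refine le_of_mul_le_mul_right ?_ (Real.log_pos one_lt_two)
  have hAB := hA.add hB
  obtain ⟨X, hX, hX'⟩ := exists_mul_conjTranspose_eq hA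
  obtain ⟨Z, hZ, hZ'⟩ := exists_mul_conjTranspose_eq hB
  obtain ⟨U, hU, hU', hW⟩ := hAB.isHermitian.exists_unitary_diagonalization
  rw [add_mul, vnEntropy_mul_log_two hA.isHermitian, vnEntropy_mul_log_two hB.isHermitian,
    vnEntropy_mul_log_two hAB.isHermitian]
  have hM : fromCols X Z * (fromCols X Z)ᴴ = A + B := by
    rw [conjTranspose_fromCols_eq_fromRows_conjTranspose, fromCols_mul_fromRows, hX, hZ]
  have hY : (Uᴴ * fromCols X Z) * (Uᴴ * fromCols X Z)ᴴ =
      diagonal (fun i => (hAB.isHermitian.eigenvalues i : ℂ)) := by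
    calc _ = Uᴴ * (fromCols X Z * (fromCols X Z)ᴴ) * U := by
          simp only [conjTranspose_mul, conjTranspose_conjTranspose, Matrix.mul_assoc]
      _ = (Uᴴ * U) * diagonal (fun i => (hAB.isHermitian.eigenvalues i : ℂ)) * (Uᴴ * U) := by
          rw [hM]
          nth_rewrite 1 [hW]
          simp only [Matrix.mul_assoc]
      _ = _ := by rw [hU, Matrix.one_mul, Matrix.mul_one]
  have hG : (Uᴴ * fromCols X Z)ᴴ * (Uᴴ * fromCols X Z) = (fromCols X Z)ᴴ * fromCols X Z := by
    rw [conjTranspose_mul, conjTranspose_conjTranspose, Matrix.mul_assoc, ← Matrix.mul_assoc U,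
      hU', Matrix.one_mul]
  refine (sum_negMulLog_le_of_mul_conjTranspose_eq_diagonal hY).trans_eq ?_
  rw [hG, conjTranspose_fromCols_eq_fromRows_conjTranspose, fromRows_mul_fromCols, hX', hZ',
    Fintype.sum_sum_type]
  simp

theorem Matrix.PosSemidef.sum_eigenvalues {n : Type*} [Fintype n] [DecidableEq n]
    {A : Matrix n n ℂ} (hA : A.PosSemidef) {T : ℝ} (hT : A.trace = T) :
    ∑ i, hA.isHermitian.eigenvalues i = T := by
  have h := hA.isHermitian.trace_eq_sum_eigenvalues
  rw [hT] at h
  simp only [Complex.coe_algebraMap] at h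
  exact_mod_cast h.symm

theorem vnEntropy_mul_log_two_le_of_trace_eq {n : Type*} [Fintype n] [DecidableEq n] [Nonempty n]
    {A : Matrix n n ℂ} (hA : A.PosSemidef) {T : ℝ} (hT : A.trace = T) :
    vnEntropy A * Real.log 2 ≤ T * Real.log (Fintype.card n) + Real.negMulLog T := by
  have hc : (0 : ℝ) < Fintype.card n := by exact_mod_cast Fintype.card_pos
  rw [vnEntropy_mul_log_two hA.isHermitian]
  have h := Real.concaveOn_negMulLog.le_map_sum (t := Finset.univ)
    (w := fun _ : n => (Fintype.card n : ℝ)⁻¹) (p := hA.isHermitian.eigenvalues)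
    (fun _ _ => by positivity) (by simp) (fun i _ => hA.eigenvalues_nonneg i)
  simp only [smul_eq_mul, ← Finset.mul_sum] at h
  rw [hA.sum_eigenvalues hT, Real.negMulLog_mul] at h
  have h2 := mul_le_mul_of_nonneg_left h hc.le
  have h3 : Real.negMulLog (Fintype.card n : ℝ)⁻¹ =
      (Fintype.card n : ℝ)⁻¹ * Real.log (Fintype.card n) := by
    rw [Real.negMulLog, Real.log_inv]; ring
  rw [h3] at h2
  field_simp at h2
  linarith

theorem negMulLog_le_negMulLog_add {p q T : ℝ} (hp : 0 ≤ p) (hq : 0 ≤ q) (hqT : q ≤ T) :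
    Real.negMulLog p ≤ Real.negMulLog (p + q) + (p + q) * Real.log (1 + T) := by
  rcases (hq.trans hqT).eq_or_lt with h0 | h0
  · obtain rfl : q = 0 := by linarith
    simp [← h0]
  · have h1 : 0 < 1 + T := by linarith
    have h := Real.concaveOn_negMulLog.2 hp (div_nonneg hq h0.le : 0 ≤ q / T)
      (by positivity : 0 ≤ (1 + T)⁻¹) (by positivity : 0 ≤ T * (1 + T)⁻¹) (by field_simp)
    have e : (1 + T)⁻¹ • p + (T * (1 + T)⁻¹) • (q / T) = (p + q) * (1 + T)⁻¹ := by
      simp only [smul_eq_mul]; field_simp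
    have h2 : 0 ≤ Real.negMulLog (q / T) :=
      Real.negMulLog_nonneg (div_nonneg hq h0.le) ((div_le_one h0).2 hqT)
    have h3 : Real.negMulLog (1 + T)⁻¹ = (1 + T)⁻¹ * Real.log (1 + T) := by
      rw [Real.negMulLog, Real.log_inv]; ring
    rw [e, Real.negMulLog_mul, h3] at h
    simp only [smul_eq_mul] at h
    have h4 : 0 ≤ T * (1 + T)⁻¹ * Real.negMulLog (q / T) := by positivity
    have h5 : (1 + T)⁻¹ * Real.negMulLog p ≤
        (1 + T)⁻¹ * (Real.negMulLog (p + q) + (p + q) * Real.log (1 + T)) := by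
      linarith
    exact le_of_mul_le_mul_left h5 (by positivity)

/-- A Fannes-type continuity bound: `ρ` and `σ` differ by positive parts of trace `T`. -/
theorem vnEntropy_sub_mul_log_two_le {n : Type*} [Fintype n] [DecidableEq n] [Nonempty n]
    {ρ σ P Q : Matrix n n ℂ} (hρ : ρ.PosSemidef) (hσ : σ.PosSemidef) (hP : P.PosSemidef)
    (hQ : Q.PosSemidef) (hρtr : ρ.trace = 1) {T : ℝ} (hPtr : P.trace = T)
    (hQtr : Q.trace = T) (h : ρ + Q = σ + P) :
    (vnEntropy ρ - vnEntropy σ) * Real.log 2 ≤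
      T * Real.log (Fintype.card n) + Real.negMulLog T + (1 + T) * Real.log (1 + T) := by
  have hW := hρ.add hQ
  have hsub : vnEntropy (ρ + Q) * Real.log 2 ≤ (vnEntropy σ + vnEntropy P) * Real.log 2 :=
    mul_le_mul_of_nonneg_right (h ▸ vnEntropy_add_le hσ hP) (Real.log_pos one_lt_two).le
  have hPle := vnEntropy_mul_log_two_le_of_trace_eq hP hPtr
  suffices vnEntropy ρ * Real.log 2 ≤
      vnEntropy (ρ + Q) * Real.log 2 + (1 + T) * Real.log (1 + T) by
    rw [sub_mul]; linarith
  obtain ⟨U, hU, hU', hUW⟩ := hW.isHermitian.exists_unitary_diagonalization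
  have hdiag (k : n) : ((Uᴴ * ρ * U) k k).re + ((Uᴴ * Q * U) k k).re =
      hW.isHermitian.eigenvalues k := by
    have e : Uᴴ * ρ * U + Uᴴ * Q * U =
        diagonal (fun i => (hW.isHermitian.eigenvalues i : ℂ)) := by
      calc _ = Uᴴ * (ρ + Q) * U := by rw [Matrix.mul_add, Matrix.add_mul]
        _ = (Uᴴ * U) * diagonal (fun i => (hW.isHermitian.eigenvalues i : ℂ)) * (Uᴴ * U) := by
          nth_rewrite 1 [hUW]
          simp only [Matrix.mul_assoc]
        _ = _ := by rw [hU, Matrix.one_mul, Matrix.mul_one]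
    rw [← Complex.add_re, ← Matrix.add_apply, e, diagonal_apply_eq, Complex.ofReal_re]
  have hp (k : n) : 0 ≤ ((Uᴴ * ρ * U) k k).re :=
    (Complex.nonneg_iff.1 (hρ.conjTranspose_mul_mul_same U).diag_nonneg).1
  have hq (k : n) : 0 ≤ ((Uᴴ * Q * U) k k).re :=
    (Complex.nonneg_iff.1 (hQ.conjTranspose_mul_mul_same U).diag_nonneg).1
  have hqsum : ∑ k, ((Uᴴ * Q * U) k k).re = T := by
    have e : (Uᴴ * Q * U).trace = T := by
      rw [Matrix.mul_assoc, Matrix.trace_mul_comm, Matrix.mul_assoc, hU', Matrix.mul_one, hQtr]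
    rw [← Complex.re_sum]
    exact (congrArg Complex.re e).trans (Complex.ofReal_re T)
  have hqT (k : n) : ((Uᴴ * Q * U) k k).re ≤ T :=
    hqsum ▸ Finset.single_le_sum (f := fun k => ((Uᴴ * Q * U) k k).re) (fun k _ => hq k)
      (Finset.mem_univ k)
  have hWtr : (ρ + Q).trace = ((1 + T : ℝ) : ℂ) := by
    rw [Matrix.trace_add, hρtr, hQtr]; push_cast; rfl
  calc vnEntropy ρ * Real.log 2 ≤ ∑ k, Real.negMulLog ((Uᴴ * ρ * U) k k).re :=
        vnEntropy_mul_log_two_le_sum_diag hρ hU'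
    _ ≤ ∑ k, (Real.negMulLog (hW.isHermitian.eigenvalues k) +
          hW.isHermitian.eigenvalues k * Real.log (1 + T)) := by
        refine Finset.sum_le_sum fun k _ => ?_
        rw [← hdiag k]
        exact negMulLog_le_negMulLog_add (hp k) (hq k) (hqT k)
    _ = _ := by
        rw [Finset.sum_add_distrib, ← Finset.sum_mul, hW.sum_eigenvalues hWtr,
          vnEntropy_mul_log_two hW.isHermitian]

theorem exists_posSemidef_add_eq_add {n : Type*} [Fintype n] [DecidableEq n]
    {ρ σ : Matrix n n ℂ} (hρ : ρ.PosSemidef) (hσ : σ.PosSemidef) (hρtr : ρ.trace = 1)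
    (hσtr : σ.trace = 1) {ε : ℝ} (hε : traceNorm (ρ - σ) ≤ ε) :
    ∃ P Q : Matrix n n ℂ, P.PosSemidef ∧ Q.PosSemidef ∧ P.trace = (ε / 2 : ℝ) ∧
      Q.trace = (ε / 2 : ℝ) ∧ ρ + Q = σ + P := by
  have hA : (ρ - σ).IsHermitian := hρ.isHermitian.sub hσ.isHermitian
  rw [traceNorm, dif_pos hA] at hε
  obtain ⟨U, hU, -, hUA⟩ := hA.exists_unitary_diagonalization
  have hsum0 : ∑ i, hA.eigenvalues i = 0 := by
    have h := hA.trace_eq_sum_eigenvalues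
    rw [Matrix.trace_sub, hρtr, hσtr, sub_self] at h
    simp only [Complex.coe_algebraMap] at h
    exact_mod_cast h.symm
  have htr (f : n → ℝ) : (U * diagonal (fun i => (f i : ℂ)) * Uᴴ).trace = (∑ i, f i : ℝ) := by
    rw [Matrix.trace_mul_comm, ← Matrix.mul_assoc, hU, Matrix.one_mul, Matrix.trace_diagonal]
    push_cast; rfl
  have hpsd (f : n → ℝ) (hf : ∀ i, 0 ≤ f i) :
      (U * diagonal (fun i => (f i : ℂ)) * Uᴴ).PosSemidef :=
    (PosSemidef.diagonal fun i => by simpa using hf i).mul_mul_conjTranspose_same U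
  set s : ℝ := (ε - ∑ i, |hA.eigenvalues i|) / 2 with hs
  have hs0 : (0 : ℂ) ≤ s := by
    have : 0 ≤ s := by rw [hs]; linarith
    exact_mod_cast this
  refine ⟨U * diagonal (fun i => (((|hA.eigenvalues i| + hA.eigenvalues i) / 2 : ℝ) : ℂ)) * Uᴴ
      + (s : ℂ) • σ,
    U * diagonal (fun i => (((|hA.eigenvalues i| - hA.eigenvalues i) / 2 : ℝ) : ℂ)) * Uᴴ
      + (s : ℂ) • σ, ?_, ?_, ?_, ?_, ?_⟩
  · exact (hpsd _ fun i => by linarith [neg_abs_le (hA.eigenvalues i)]).add (hσ.smul hs0)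
  · exact (hpsd _ fun i => by linarith [le_abs_self (hA.eigenvalues i)]).add (hσ.smul hs0)
  · rw [Matrix.trace_add, htr, Matrix.trace_smul, hσtr, ← Finset.sum_div, Finset.sum_add_distrib,
      hsum0, hs]
    push_cast
    simp only [smul_eq_mul]
    ring
  · rw [Matrix.trace_add, htr, Matrix.trace_smul, hσtr, ← Finset.sum_div, Finset.sum_sub_distrib,
      hsum0, hs]
    push_cast
    simp only [smul_eq_mul]
    ring
  · have hd : U * diagonal (fun i => (((|hA.eigenvalues i| + hA.eigenvalues i) / 2 : ℝ) : ℂ)) * Uᴴ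
        - U * diagonal (fun i => (((|hA.eigenvalues i| - hA.eigenvalues i) / 2 : ℝ) : ℂ)) * Uᴴ
        = ρ - σ := by
      nth_rewrite 5 [hUA]
      rw [← Matrix.sub_mul, ← Matrix.mul_sub, diagonal_sub]
      congr 3
      funext i
      push_cast
      ring
    rw [sub_eq_sub_iff_add_eq_add] at hd
    rw [← add_assoc, ← add_assoc, add_left_inj, add_comm σ, ← hd]

theorem concaveOn_negMulLog_comp_linear {a b : ℝ} {s : Set ℝ} (hs : Convex ℝ s)
    (h : ∀ x ∈ s, 0 ≤ a + b * x) : ConcaveOn ℝ s (fun x => Real.negMulLog (a + b * x)) := by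
  refine ⟨hs, fun x hx y hy t u ht hu htu => ?_⟩
  have := Real.concaveOn_negMulLog.2 (h x hx) (h y hy) ht hu htu
  refine this.trans_eq ?_
  simp only [smul_eq_mul]
  congr 1
  linear_combination a * htu

theorem three_mul_log_two_le {T : ℝ} (h0 : 0 ≤ T) (h1 : T ≤ 3 / 16) :
    3 * T * Real.log 2 ≤
      Real.negMulLog T + Real.negMulLog (1 - 2 * T) + Real.negMulLog (1 + T) := by
  have hs : Convex ℝ (Set.Icc (0 : ℝ) (3 / 16)) := convex_Icc _ _
  have hc1 : ConcaveOn ℝ (Set.Icc (0 : ℝ) (3 / 16)) (fun x => Real.negMulLog (0 + 1 * x)) :=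
    concaveOn_negMulLog_comp_linear hs fun x hx => by linarith [hx.1]
  have hc2 : ConcaveOn ℝ (Set.Icc (0 : ℝ) (3 / 16)) (fun x => Real.negMulLog (1 + (-2) * x)) :=
    concaveOn_negMulLog_comp_linear hs fun x hx => by linarith [hx.2]
  have hc3 : ConcaveOn ℝ (Set.Icc (0 : ℝ) (3 / 16)) (fun x => Real.negMulLog (1 + 1 * x)) :=
    concaveOn_negMulLog_comp_linear hs fun x hx => by linarith [hx.1]
  have h := ((hc1.add hc2).add hc3).2 (Set.left_mem_Icc.2 (by norm_num))
    (Set.right_mem_Icc.2 (by norm_num)) (by linarith : 0 ≤ 1 - 16 / 3 * T)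
    (by linarith : 0 ≤ 16 / 3 * T) (by ring)
  have e : (1 - 16 / 3 * T) • (0 : ℝ) + (16 / 3 * T) • (3 / 16 : ℝ) = T := by
    simp only [smul_eq_mul]; ring
  rw [e] at h
  simp only [Pi.add_apply, smul_eq_mul, mul_zero, add_zero, zero_add, one_mul,
    Real.negMulLog_zero, Real.negMulLog_one] at h
  have hend : 9 / 16 * Real.log 2 ≤ Real.negMulLog (3 / 16) + Real.negMulLog (1 + -2 * (3 / 16)) +
      Real.negMulLog (1 + 3 / 16) := by
    have l16 : Real.log 16 = 4 * Real.log 2 := by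
      rw [show (16 : ℝ) = 2 ^ 4 by norm_num, Real.log_pow]; norm_num
    have l8 : Real.log 8 = 3 * Real.log 2 := by
      rw [show (8 : ℝ) = 2 ^ 3 by norm_num, Real.log_pow]; norm_num
    have key : 3 * Real.log 3 + 10 * Real.log 5 + 19 * Real.log 19 ≤ 109 * Real.log 2 := by
      have := Real.log_le_log (x := 3 ^ 3 * 5 ^ 10 * 19 ^ 19) (y := 2 ^ 109) (by norm_num)
        (by norm_num)
      rw [Real.log_mul (by norm_num) (by norm_num), Real.log_mul (by norm_num) (by norm_num),
        Real.log_pow, Real.log_pow, Real.log_pow, Real.log_pow] at this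
      exact_mod_cast this
    rw [show (1 + -2 * (3 / 16) : ℝ) = 5 / 8 by norm_num,
      show (1 + 3 / 16 : ℝ) = 19 / 16 by norm_num]
    simp only [Real.negMulLog]
    rw [Real.log_div (by norm_num) (by norm_num), Real.log_div (by norm_num) (by norm_num),
      Real.log_div (by norm_num) (by norm_num), l16, l8]
    linarith
  have h' := mul_le_mul_of_nonneg_left hend (by linarith : 0 ≤ 16 / 3 * T)
  rw [show 1 - 2 * T = 1 + -2 * T by ring]
  linarith

theorem fannes_bound_le_s4 {d : ℕ} (hd : 2 ≤ d) {ε : ℝ} (hε0 : 0 ≤ ε) (hε1 : ε < 1 / Real.exp 1) :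
    ε / 2 * Real.log d + Real.negMulLog (ε / 2) + (1 + ε / 2) * Real.log (1 + ε / 2) ≤
      (ε * Real.logb 2 ((d : ℝ) - 1) + binEntropy ε) * Real.log 2 := by
  have hd' : (2 : ℝ) ≤ d := by exact_mod_cast hd
  have hlog2 : Real.log 2 ≠ 0 := (Real.log_pos one_lt_two).ne'
  have hT : ε / 2 ≤ 3 / 16 := by
    have h : 1 / Real.exp 1 ≤ 3 / 8 := by
      rw [div_le_div_iff₀ (Real.exp_pos 1) (by norm_num)]
      linarith [Real.exp_one_gt_d9]
    linarith
  have hlogd : Real.log d ≤ Real.log 2 + 2 * Real.log ((d : ℝ) - 1) := by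
    have h1 : (0 : ℝ) < d - 1 := by linarith
    have := Real.log_le_log (x := d) (y := 2 * ((d : ℝ) - 1) ^ 2) (by linarith) (by nlinarith)
    rwa [Real.log_mul (by norm_num) (by positivity), Real.log_pow, Nat.cast_ofNat] at this
  have hbin : binEntropy ε * Real.log 2 = Real.negMulLog ε + Real.negMulLog (1 - ε) := by
    simp only [binEntropy, Real.logb, Real.negMulLog]
    field_simp
    ring
  have hhalf : Real.negMulLog ε = 2 * Real.negMulLog (ε / 2) - ε * Real.log 2 := by
    conv_lhs => rw [show ε = 2 * (ε / 2) by ring, Real.negMulLog_mul]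
    rw [Real.negMulLog]
    ring
  have h3 := three_mul_log_two_le (by linarith : 0 ≤ ε / 2) hT
  have hplus : Real.negMulLog (1 + ε / 2) = -((1 + ε / 2) * Real.log (1 + ε / 2)) := by
    rw [Real.negMulLog]; ring
  rw [hplus, show 1 - 2 * (ε / 2) = 1 - ε by ring] at h3
  have h4 := mul_le_mul_of_nonneg_left hlogd (by linarith : 0 ≤ ε / 2)
  rw [add_mul _ (binEntropy ε), hbin, hhalf, Real.logb, mul_assoc, div_mul_cancel₀ _ hlog2]
  linarith

/-- **Holevo quantity of an ensemble close to a constant state.** -/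
theorem holevo_close_to_constant (d N : ℕ) (hd : 2 ≤ d) (hN : 0 < N)
    (Ξ : Matrix (Fin d) (Fin d) ℂ) (ζ : Fin N → Matrix (Fin d) (Fin d) ℂ)
    (hΞ : Ξ.PosSemidef) (hΞtr : Ξ.trace = 1)
    (hζ : ∀ i, (ζ i).PosSemidef) (hζtr : ∀ i, (ζ i).trace = 1)
    (ε : ℝ) (hε0 : 0 ≤ ε) (hε1 : ε < 1 / Real.exp 1)
    (hdist : ∀ i, traceNorm (ζ i - Ξ) ≤ ε) :
    vnEntropy ((1 / (N : ℂ)) • ∑ i, ζ i) - (1 / (N : ℝ)) * ∑ i, vnEntropy (ζ i)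
      ≤ 2 * ε * Real.logb 2 ((d : ℝ) - 1) + 2 * binEntropy ε := by
  have : Nonempty (Fin d) := ⟨⟨0, by omega⟩⟩
  have hNR : (N : ℝ) ≠ 0 := by exact_mod_cast hN.ne'
  have hNC : (N : ℂ) ≠ 0 := by exact_mod_cast hN.ne'
  have hN0 : (0 : ℂ) ≤ 1 / (N : ℂ) := by
    rw [← Complex.ofReal_natCast, ← Complex.ofReal_one, ← Complex.ofReal_div,
      Complex.zero_le_real]
    positivity
  have hbound := fannes_bound_le_s4 hd hε0 hε1
  choose P Q hP hQ hPtr hQtr hPQ using fun i =>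
    exists_posSemidef_add_eq_add (hζ i) hΞ (hζtr i) hΞtr (hdist i)
  have hpsd {A : Fin N → Matrix (Fin d) (Fin d) ℂ} (hA : ∀ i, (A i).PosSemidef) :
      ((1 / (N : ℂ)) • ∑ i, A i).PosSemidef :=
    (posSemidef_sum _ fun i _ => hA i).smul hN0
  have htr {A : Fin N → Matrix (Fin d) (Fin d) ℂ} {c : ℂ} (hA : ∀ i, (A i).trace = c) :
      ((1 / (N : ℂ)) • ∑ i, A i).trace = c := by
    rw [trace_smul, trace_sum, Finset.sum_congr rfl fun i _ => hA i]
    simp only [Finset.sum_const, Finset.card_univ, Fintype.card_fin, nsmul_eq_mul, smul_eq_mul]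
    field_simp
  have havg : (1 / (N : ℂ)) • ∑ i, ζ i + (1 / (N : ℂ)) • ∑ i, Q i =
      Ξ + (1 / (N : ℂ)) • ∑ i, P i := by
    rw [← smul_add, ← Finset.sum_add_distrib, Finset.sum_congr rfl fun i _ => hPQ i,
      Finset.sum_add_distrib, smul_add, Finset.sum_const, Finset.card_univ, Fintype.card_fin,
      ← Nat.cast_smul_eq_nsmul ℂ, smul_smul, one_div_mul_cancel hNC, one_smul]
  have h1 : vnEntropy ((1 / (N : ℂ)) • ∑ i, ζ i) - vnEntropy Ξ ≤
      ε * Real.logb 2 ((d : ℝ) - 1) + binEntropy ε := by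
    refine le_of_mul_le_mul_right (le_trans ?_ hbound) (Real.log_pos one_lt_two)
    simpa only [Fintype.card_fin] using
      vnEntropy_sub_mul_log_two_le (hpsd hζ) hΞ (hpsd hP) (hpsd hQ) (htr hζtr) (htr hPtr)
        (htr hQtr) havg
  have h2 (i : Fin N) : vnEntropy Ξ - vnEntropy (ζ i) ≤
      ε * Real.logb 2 ((d : ℝ) - 1) + binEntropy ε := by
    refine le_of_mul_le_mul_right (le_trans ?_ hbound) (Real.log_pos one_lt_two)
    simpa only [Fintype.card_fin] using
      vnEntropy_sub_mul_log_two_le hΞ (hζ i) (hQ i) (hP i) hΞtr (hQtr i) (hPtr i) (hPQ i).symm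
  have h3 : vnEntropy Ξ - (1 / (N : ℝ)) * ∑ i, vnEntropy (ζ i) ≤
      ε * Real.logb 2 ((d : ℝ) - 1) + binEntropy ε := by
    have h := Finset.sum_le_sum fun i (_ : i ∈ Finset.univ) => h2 i
    rw [Finset.sum_sub_distrib, Finset.sum_const, Finset.sum_const, Finset.card_univ,
      Fintype.card_fin, nsmul_eq_mul, nsmul_eq_mul] at h
    have h' := mul_le_mul_of_nonneg_left h (by positivity : 0 ≤ 1 / (N : ℝ))
    rwa [mul_sub, ← mul_assoc, ← mul_assoc, one_div_mul_cancel hNR, one_mul, one_mul] at h'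
  linarith
end
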